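/- For all integers k ≥ 0 and m, t ≥ 1 there exist reals ε, C > 0 with the following property. Let G be a finite graph with at least C vertices of treewidth at most k that contains neither K_{t,m} nor I_{t-1}+P_m as a minor, and let S ⊆ V(G) satisfy |S| ≤ ε·|V(G)| + 2k + 3. Then G contains a t-island disjoint from S. -/

import Mathlib

open SimpleGraph

/-- `S` is a `t`-island in `G`: a nonempty set of vertices each of which has
fewer than `t` neighbors outside `S`. -/
def IsIsland {V : Type*} (G : SimpleGraph V) (t : ℕ) (S : Set V) : Prop :=
  S.Nonempty ∧ ∀ v ∈ S, ((G.neighborSet v) \ S).ncard < t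

/-- `H` is a minor of `G`: there is a model of `H` in `G`. -/
def IsMinorOf {W V : Type*} (H : SimpleGraph W) (G : SimpleGraph V) : Prop :=
  ∃ μ : W → Set V,
    (∀ w, (μ w).Nonempty) ∧
    (∀ w, (G.induce (μ w)).Connected) ∧
    (Pairwise fun w₁ w₂ => Disjoint (μ w₁) (μ w₂)) ∧
    (∀ ⦃w₁ w₂⦄, H.Adj w₁ w₂ → ∃ u ∈ μ w₁, ∃ v ∈ μ w₂, G.Adj u v)

/-- The graph `I_n + P_m`: a path on `m` vertices together with `n` additional
pairwise non-adjacent vertices, each adjacent to every vertex of the path. -/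
def IplusP (n m : ℕ) : SimpleGraph (Fin n ⊕ Fin m) :=
  SimpleGraph.fromRel (fun a b =>
    (∃ i j, a = Sum.inl i ∧ b = Sum.inr j) ∨
    (∃ i j : Fin m, a = Sum.inr i ∧ b = Sum.inr j ∧ (i : ℕ) + 1 = (j : ℕ)))

/-- `c` is a coloring of `G` with clustering `C`: every monochromatic connected
subgraph has at most `C` vertices. -/
def ClusteredColoring {V α : Type*} (G : SimpleGraph V) (C : ℕ) (c : V → α) : Prop :=
  ∀ S : Set V, (G.induce S).Connected → (∀ u ∈ S, ∀ v ∈ S, c u = c v) → S.ncard ≤ C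

/-- `G` has a tree decomposition of width at most `w`. -/
def HasTreewidthAtMost {V : Type*} (G : SimpleGraph V) (w : ℕ) : Prop :=
  ∃ (n : ℕ) (T : SimpleGraph (Fin n)) (β : Fin n → Set V), T.IsTree ∧
    (∀ ⦃u v⦄, G.Adj u v → ∃ x, u ∈ β x ∧ v ∈ β x) ∧
    (∀ v : V, (T.induce {x | v ∈ β x}).Connected) ∧
    (∀ x, (β x).ncard ≤ w + 1)

/-- A class of graphs, given for each `n` as a collection of graphs on `Fin n`. -/
def MemClass (𝒢 : ∀ n : ℕ, SimpleGraph (Fin n) → Prop) {V : Type*} (G : SimpleGraph V) : Prop :=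
  ∃ (n : ℕ) (G' : SimpleGraph (Fin n)), 𝒢 n G' ∧ Nonempty (G ≃g G')

/-- `𝒢` is a (proper) minor-closed class. -/
def MinorClosed (𝒢 : ∀ n : ℕ, SimpleGraph (Fin n) → Prop) : Prop :=
  (∃ (n : ℕ) (G : SimpleGraph (Fin n)), ¬ 𝒢 n G) ∧
  ∀ ⦃n k : ℕ⦄ (G : SimpleGraph (Fin n)) (H : SimpleGraph (Fin k)),
    𝒢 n G → IsMinorOf H G → 𝒢 k H

/-- `𝒢` is closed under taking subgraphs (up to isomorphism). -/
def SubgraphClosed (𝒢 : ∀ n : ℕ, SimpleGraph (Fin n) → Prop) : Prop :=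
  ∀ ⦃n k : ℕ⦄ (G : SimpleGraph (Fin n)) (H : SimpleGraph (Fin k)), 𝒢 n G →
    (∃ f : Fin k → Fin n, Function.Injective f ∧ ∀ ⦃a b⦄, H.Adj a b → G.Adj (f a) (f b)) →
    𝒢 k H

/-- The vertices that eventually become active in bootstrap `t`-percolation
starting from the active set `A`. -/
inductive PercolationActive {V : Type*} (G : SimpleGraph V) (t : ℕ) (A : Set V) : V → Prop
  | base (v : V) : v ∈ A → PercolationActive G t A v
  | step (v : V) (N : Finset V) : t ≤ N.card → (∀ u ∈ N, G.Adj v u) →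
      (∀ u ∈ N, PercolationActive G t A u) → PercolationActive G t A v

/-- The set `A` `t`-percolates in `G`. -/
def Percolates {V : Type*} (G : SimpleGraph V) (t : ℕ) (A : Set V) : Prop :=
  ∀ v, PercolationActive G t A v

/-- `G` contains `k` pairwise disjoint `t`-islands. -/
def HasDisjointIslands {V : Type*} (G : SimpleGraph V) (t k : ℕ) : Prop :=
  ∃ f : Fin k → Set V, (∀ i, IsIsland G t (f i)) ∧ Pairwise (Function.onFun Disjoint f)

/-- `f` is significantly sublinear: `∑ f(⌈(3/2)^i⌉)/(3/2)^i` is finite. -/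
def SignificantlySublinear (f : ℕ → ℕ) : Prop :=
  Summable (fun i : ℕ => (f ⌈((3:ℝ)/2)^i⌉₊ : ℝ) / ((3:ℝ)/2)^i)

/-- The class `𝒢` has `f`-separators. -/
def HasSeparators (f : ℕ → ℕ) (𝒢 : ∀ n : ℕ, SimpleGraph (Fin n) → Prop) : Prop :=
  ∀ (n : ℕ) (G : SimpleGraph (Fin n)), 𝒢 n G →
    ∃ L R : G.Subgraph, L ⊔ R = ⊤ ∧ (L.verts ∩ R.verts).ncard ≤ f n ∧
      3 * (L.verts \ R.verts).ncard ≤ 2 * n ∧ 3 * (R.verts \ L.verts).ncard ≤ 2 * n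

/-- The number of edges of `G` with at least one end in `A`. -/
noncomputable def edgesTouching {V : Type*} (G : SimpleGraph V) (A : Set V) : ℕ :=
  {e ∈ G.edgeSet | ∃ v ∈ A, v ∈ e}.ncard

namespace Islands

open scoped Classical

/-- The vertices outside `U` with a neighbor in `U`. -/
noncomputable def boundary {V : Type*} [Fintype V] (G : SimpleGraph V) (U : Finset V) : Finset V :=
  Finset.univ.filter fun w => w ∉ U ∧ ∃ u ∈ U, G.Adj u w

section Connectivity

variable {V : Type*} {G : SimpleGraph V}

lemma subset_of_connected {s B : Set V} (hs : (G.induce s).Connected) {a : V} (has : a ∈ s)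
    (haB : a ∈ B) (hB : ∀ x ∈ B, x ∈ s → ∀ y ∈ s, G.Adj x y → y ∈ B) : s ⊆ B := by
  intro y hy
  obtain ⟨w⟩ := hs.preconnected ⟨a, has⟩ ⟨y, hy⟩
  suffices ∀ (p q : s), (G.induce s).Walk p q → (p : V) ∈ B → (q : V) ∈ B from this _ _ w haB
  intro p q w
  induction w with
  | nil => exact id
  | cons h _ ih => exact fun hp => ih (hB _ hp (Subtype.coe_prop _) _ (Subtype.coe_prop _) h)

lemma connected_of_closed {s : Set V} {a : V} (has : a ∈ s)
    (h : ∀ B : Set V, a ∈ B → (∀ x ∈ B, x ∈ s → ∀ y ∈ s, G.Adj x y → y ∈ B) → s ⊆ B) :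
    (G.induce s).Connected := by
  rw [connected_iff_exists_forall_reachable]
  refine ⟨⟨a, has⟩, fun ⟨y, hy⟩ => ?_⟩
  have := h {x | ∃ hx : x ∈ s, (G.induce s).Reachable ⟨a, has⟩ ⟨x, hx⟩} ⟨has, Reachable.refl _⟩
    (fun x ⟨hx, hr⟩ _ y hy hxy => ⟨hy, hr.trans (Adj.reachable (by simpa using hxy))⟩) hy
  exact this.2

lemma connected_singleton (v : V) : (G.induce {v}).Connected :=
  connected_of_closed (Set.mem_singleton v) fun B hv _ => by simpa using hv

variable [Fintype V]

lemma mem_boundary {U : Finset V} {w : V} :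
    w ∈ boundary G U ↔ w ∉ U ∧ ∃ u ∈ U, G.Adj u w := by
  simp [boundary]

lemma mem_boundary_of_adj {U : Finset V} {u w : V} (hu : u ∈ U) (h : G.Adj u w) (hw : w ∉ U) :
    w ∈ boundary G U :=
  mem_boundary.2 ⟨hw, u, hu, h⟩

lemma subset_of_connected_of_disjoint_boundary {s : Set V} {U : Finset V}
    (hs : (G.induce s).Connected) {a : V} (has : a ∈ s) (haU : a ∈ U)
    (hd : ∀ x ∈ s, x ∉ boundary G U) : s ⊆ U :=
  subset_of_connected hs has haU fun x hx _ y hy hxy => by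
    by_contra hyU
    exact hd y hy (mem_boundary_of_adj hx hxy hyU)

end Connectivity

section TreeDecomposition

variable {V W : Type*} {T : SimpleGraph W}

lemma parent_unique (hT : T.IsTree) {r z p q : W} (hp : T.Adj p z) (hq : T.Adj q z)
    (hpd : T.dist r z = T.dist r p + 1) (hqd : T.dist r z = T.dist r q + 1) : p = q := by
  obtain ⟨a, ha, hal⟩ := hT.connected.exists_path_of_dist r z
  have key : ∀ p, T.Adj p z → T.dist r z = T.dist r p + 1 → p = a.penultimate := by
    intro p hp hpd
    obtain ⟨b, hb, hbl⟩ := hT.connected.exists_path_of_dist r p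
    refine hT.isAcyclic.eq_penultimate_of_adj_end ha hp.symm ?_
    refine hT.isAcyclic.mem_support_of_ne_mem_support_of_adj_of_isPath ha hb hp.symm ?_
    intro hz
    have := (dist_le (b.takeUntil z hz)).trans (b.length_takeUntil_le_length hz)
    omega
  rw [key p hp hpd, key q hq hqd]

/-- The nodes of `T` below `x` when `T` is rooted at `r`. -/
def below (T : SimpleGraph W) (r x : W) : Set W :=
  {y | T.dist r y = T.dist r x + T.dist x y}

lemma mem_below_self (r x : W) : x ∈ below T r x := by simp [below]

lemma mem_below_of_adj (hT : T.IsTree) {r x y z : W} (hy : y ∈ below T r x) (hyz : T.Adj y z)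
    (hz : T.dist r x ≤ T.dist r z) : z ∈ below T r x := by
  simp only [below, Set.mem_ofPred_eq] at *
  have tri := hT.connected.dist_triangle (u := r) (v := x) (w := z)
  rcases hT.dist_eq_dist_add_one_of_adj r hyz with h | h
  · have hne : x ≠ y := by
      rintro rfl
      simp at hy
      omega
    obtain ⟨p, hp⟩ := hT.connected.exists_walk_length_eq_dist x y
    have hnil : ¬ p.Nil := fun h => hne h.eq
    have hadj := p.adj_penultimate hnil
    have h1 := dist_le p.dropLast
    have h2 := hT.connected.dist_triangle (u := r) (v := x) (w := p.penultimate)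
    have h3 : p.dropLast.length + 1 = p.length := by
      rw [p.length_dropLast_add_one hnil]
    have h4 := hT.dist_eq_dist_add_one_of_adj r hadj
    have h5 := hT.dist_eq_dist_add_one_of_adj x hadj
    have h6 : z = p.penultimate := parent_unique hT hyz.symm hadj h (by omega)
    rw [h6] at h ⊢
    omega
  · have h5 := hT.dist_eq_dist_add_one_of_adj x hyz
    omega

lemma subset_below (hT : T.IsTree) {r x z : W} {Y : Set W} (hY : (T.induce Y).Connected)
    (hz : z ∈ Y) (hzx : z ∈ below T r x) (hd : ∀ y ∈ Y, T.dist r x ≤ T.dist r y) :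
    Y ⊆ below T r x :=
  subset_of_connected hY hz hzx fun _ ha _ b hb hab => mem_below_of_adj hT ha hab (hd b hb)

lemma mem_of_connected_of_below (hT : T.IsTree) {r x y z : W} {Y : Set W}
    (hY : (T.induce Y).Connected) (hz : z ∈ Y) (hzx : z ∈ below T r x) (hy : y ∈ Y)
    (hyx : T.dist r y ≤ T.dist r x) : x ∈ Y := by
  by_contra hx
  have hne : ∀ {a}, a ∈ Y → x ≠ a := fun ha h => hx (h ▸ ha)
  have key : Y ⊆ below T r x := by
    refine subset_of_connected hY hz hzx fun a ha haY b hb hab => mem_below_of_adj hT ha hab ?_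
    have h1 := hT.connected.pos_dist_of_ne (hne haY)
    have h2 := hT.dist_eq_dist_add_one_of_adj r hab
    simp only [below, Set.mem_ofPred_eq] at ha
    omega
  have h1 := hT.connected.pos_dist_of_ne (hne hy)
  have h2 : T.dist r y = T.dist r x + T.dist x y := key hy
  omega

lemma exists_depth [Fintype V] {G : SimpleGraph V} {k : ℕ} (h : HasTreewidthAtMost G k) :
    ∃ δ : V → ℕ, ∀ U : Finset V, (G.induce (U : Set V)).Connected →
      (∀ w ∈ boundary G U, ∀ u ∈ U, δ w ≤ δ u) → (boundary G U).card ≤ k + 1 := by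
  obtain ⟨n, T, β, hT, hadj, hconn, hcard⟩ := h
  obtain ⟨r⟩ := hT.connected.nonempty
  let δ : V → ℕ := fun v => sInf (T.dist r '' {x | v ∈ β x})
  have hδ : ∀ v, ∃ x, v ∈ β x ∧ T.dist r x = δ v := by
    intro v
    obtain ⟨⟨x, hx⟩⟩ := (hconn v).nonempty
    obtain ⟨y, hy, hyd⟩ := Nat.sInf_mem (s := T.dist r '' {x | v ∈ β x}) ⟨_, x, hx, rfl⟩
    exact ⟨y, hy, hyd⟩
  have hδle : ∀ v x, v ∈ β x → δ v ≤ T.dist r x := fun v x hx => Nat.sInf_le ⟨x, hx, rfl⟩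
  refine ⟨δ, fun U hU hb => ?_⟩
  obtain ⟨⟨u₁, hu₁⟩⟩ := hU.nonempty
  obtain ⟨u, hu, hmin⟩ := U.exists_min_image δ ⟨u₁, hu₁⟩
  obtain ⟨x, hx, hxd⟩ := hδ u
  have hge : ∀ v ∈ U, ∀ y, v ∈ β y → T.dist r x ≤ T.dist r y := fun v hv y hy =>
    hxd.trans_le ((hmin v hv).trans (hδle v y hy))
  have hbelow : (U : Set V) ⊆ {v | {y | v ∈ β y} ⊆ below T r x} := by
    refine subset_of_connected hU hu ?_ ?_
    · exact subset_below hT (hconn u) hx (mem_below_self r x) (hge u hu)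
    · intro a ha _ b hbU hab
      obtain ⟨z, hza, hzb⟩ := hadj hab
      exact subset_below hT (hconn b) hzb (ha hza) (hge b hbU)
  have hsub : ((boundary G U : Finset V) : Set V) ⊆ β x := by
    intro w hw
    obtain ⟨-, v, hv, hvw⟩ := mem_boundary.1 hw
    obtain ⟨z, hzv, hzw⟩ := hadj hvw
    obtain ⟨y, hy, hyd⟩ := hδ w
    exact mem_of_connected_of_below hT (hconn w) hzw (hbelow hv hzv) hy
      (by rw [hyd, hxd]; exact hb w hw u hu)
  have := Set.ncard_le_ncard hsub (Set.toFinite _)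
  rw [Set.ncard_coe_finset] at this
  exact this.trans (hcard x)

end TreeDecomposition

section Minors

variable {V : Type*} {G : SimpleGraph V}

lemma isMinorOf_sum {A B : Type*} {H : SimpleGraph (A ⊕ B)} (F : A → Set V) (K : B → Set V)
    (hF : ∀ a, (G.induce (F a)).Connected) (hK : ∀ b, (G.induce (K b)).Connected)
    (dF : Pairwise fun a a' => Disjoint (F a) (F a'))
    (dK : Pairwise fun b b' => Disjoint (K b) (K b'))
    (dFK : ∀ a b, Disjoint (F a) (K b))
    (hLL : ∀ a a', ¬ H.Adj (.inl a) (.inl a'))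
    (hLR : ∀ a b, ∃ u ∈ F a, ∃ v ∈ K b, G.Adj u v)
    (hRR : ∀ b b', H.Adj (.inr b) (.inr b') → ∃ u ∈ K b, ∃ v ∈ K b', G.Adj u v) :
    IsMinorOf H G := by
  have hconn : ∀ w, (G.induce (Sum.elim F K w)).Connected := by
    rintro (a | b)
    exacts [hF a, hK b]
  refine ⟨Sum.elim F K, fun w => ?_, hconn, ?_, ?_⟩
  · obtain ⟨x⟩ := (hconn w).nonempty
    exact ⟨x, x.2⟩
  · rintro (a | b) (a' | b') h
    · exact dF (by simpa using h)
    · exact dFK a b'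
    · exact (dFK a' b).symm
    · exact dK (by simpa using h)
  · rintro (a | b) (a' | b') h
    · exact (hLL _ _ h).elim
    · exact hLR a b'
    · obtain ⟨u, hu, v, hv, huv⟩ := hLR a' b
      exact ⟨v, hv, u, hu, huv.symm⟩
    · exact hRR b b' h

lemma completeBipartite_isMinorOf {α β : Type*} {t m : ℕ} {T : Finset α} {M : Finset β}
    (hT : T.card = t) (hM : m ≤ M.card) (F : α → Set V) (K : β → Set V)
    (hF : ∀ a ∈ T, (G.induce (F a)).Connected) (hK : ∀ b ∈ M, (G.induce (K b)).Connected)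
    (dF : ∀ a ∈ T, ∀ a' ∈ T, a ≠ a' → Disjoint (F a) (F a'))
    (dK : ∀ b ∈ M, ∀ b' ∈ M, b ≠ b' → Disjoint (K b) (K b'))
    (dFK : ∀ a ∈ T, ∀ b ∈ M, Disjoint (F a) (K b))
    (hFK : ∀ a ∈ T, ∀ b ∈ M, ∃ u ∈ F a, ∃ v ∈ K b, G.Adj u v) :
    IsMinorOf (completeBipartiteGraph (Fin t) (Fin m)) G := by
  obtain ⟨M', hM', rfl⟩ := Finset.exists_subset_card_eq hM
  subst hT
  let f := T.equivFin.symm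
  let g := M'.equivFin.symm
  have hg : ∀ i, (g i : β) ∈ M := fun i => hM' (g i).2
  refine isMinorOf_sum (fun i => F (f i)) (fun i => K (g i)) (fun i => hF _ (f i).2)
    (fun i => hK _ (hg i)) (fun i j h => dF _ (f i).2 _ (f j).2 ?_)
    (fun i j h => dK _ (hg i) _ (hg j) ?_) (fun i j => dFK _ (f i).2 _ (hg j)) ?_
    (fun i j => hFK _ (f i).2 _ (hg j)) ?_
  · simpa [Subtype.ext_iff] using f.injective.ne h
  · simpa [Subtype.ext_iff] using g.injective.ne h
  · simp
  · simp

lemma IplusP_isMinorOf {α : Type*} {n m : ℕ} {T : Finset α}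
    (hT : T.card = n) (F : α → Set V) (K : Fin m → Set V)
    (hF : ∀ a ∈ T, (G.induce (F a)).Connected) (hK : ∀ b, (G.induce (K b)).Connected)
    (dF : ∀ a ∈ T, ∀ a' ∈ T, a ≠ a' → Disjoint (F a) (F a'))
    (dK : Pairwise fun b b' => Disjoint (K b) (K b'))
    (dFK : ∀ a ∈ T, ∀ b, Disjoint (F a) (K b))
    (hFK : ∀ a ∈ T, ∀ b, ∃ u ∈ F a, ∃ v ∈ K b, G.Adj u v)
    (hKK : ∀ i j : Fin m, (i : ℕ) + 1 = j → ∃ u ∈ K i, ∃ v ∈ K j, G.Adj u v) :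
    IsMinorOf (IplusP n m) G := by
  subst hT
  let f := T.equivFin.symm
  refine isMinorOf_sum (fun i => F (f i)) K (fun i => hF _ (f i).2) hK
    (fun i j h => dF _ (f i).2 _ (f j).2 ?_) dK (fun i j => dFK _ (f i).2 j) ?_
    (fun i j => hFK _ (f i).2 j) ?_
  · simpa [Subtype.ext_iff] using f.injective.ne h
  · simp [IplusP]
  · intro i j h
    simp only [IplusP, fromRel_adj, reduceCtorEq, false_and, exists_false, Sum.inr.injEq,
      false_or] at h
    rcases h.2 with ⟨i', j', rfl, rfl, h⟩ | ⟨i', j', rfl, rfl, h⟩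
    · exact hKK _ _ h
    · obtain ⟨u, hu, v, hv, huv⟩ := hKK _ _ h
      exact ⟨v, hv, u, hu, huv.symm⟩

lemma exists_path_segments {a b : V} {P : G.Walk a b} (hP : P.IsPath) {M : Finset V} {m : ℕ}
    (hm : m ≤ M.card) (hM : ∀ x ∈ M, x ∈ P.support) :
    ∃ K : Fin m → Set V, (∀ i, (G.induce (K i)).Connected) ∧ (∀ i, K i ⊆ {x | x ∈ P.support}) ∧
      (Pairwise fun i j => Disjoint (K i) (K j)) ∧ (∀ i, ∃ x ∈ M, x ∈ K i) ∧
      ∀ i j : Fin m, (i : ℕ) + 1 = j → ∃ u ∈ K i, ∃ v ∈ K j, G.Adj u v := by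
  let I : Finset ℕ := (Finset.range (P.length + 1)).filter fun n => P.getVert n ∈ M
  have hI : m ≤ I.card := by
    have : M ⊆ I.image P.getVert := by
      intro x hx
      obtain ⟨n, rfl, hn⟩ := Walk.mem_support_iff_exists_getVert.1 (hM x hx)
      exact Finset.mem_image_of_mem _
        (Finset.mem_filter.2 ⟨Finset.mem_range.2 (Nat.lt_succ_of_le hn), hx⟩)
    exact hm.trans ((Finset.card_le_card this).trans Finset.card_image_le)
  let σ := I.orderEmbOfCardLe hI
  have hσI : ∀ i, σ i ≤ P.length ∧ P.getVert (σ i) ∈ M := by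
    intro i
    have := I.orderEmbOfCardLe_mem hI i
    simp only [I, Finset.mem_filter, Finset.mem_range] at this
    exact ⟨Nat.le_of_lt_succ this.1, this.2⟩
  let N : Fin m → Set ℕ := fun i => {n | σ i ≤ n ∧ n ≤ P.length ∧ ∀ j, i < j → n < σ j}
  have hσN : ∀ i, σ i ∈ N i := fun i => ⟨le_rfl, (hσI i).1, fun j hj => σ.strictMono hj⟩
  have hlt : ∀ i j, i < j → Disjoint (P.getVert '' N i) (P.getVert '' N j) := by
    intro i j hij
    rw [Set.disjoint_left]
    rintro _ ⟨n, hn, rfl⟩ ⟨n', hn', h⟩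
    have := hP.getVert_injOn hn'.2.1 hn.2.1 h
    subst this
    exact absurd (hn.2.2 j hij) hn'.1.not_gt
  refine ⟨fun i => P.getVert '' N i, fun i => ?_, ?_, ?_, ?_, ?_⟩
  · refine connected_of_closed (Set.mem_image_of_mem _ (hσN i)) ?_
    rintro B hB hcl _ ⟨n, ⟨hn, hnl, hnσ⟩, rfl⟩
    induction n, hn using Nat.le_induction with
    | base => exact hB
    | succ n hn ih =>
      have hnN : n ∈ N i := ⟨hn, by omega, fun j hj => (Nat.lt_succ_self n).trans (hnσ j hj)⟩
      exact hcl _ (ih hnN.2.1 hnN.2.2) ⟨n, hnN, rfl⟩ _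
        ⟨n + 1, ⟨by omega, hnl, hnσ⟩, rfl⟩ (P.adj_getVert_succ (by omega))
  · rintro i _ ⟨n, -, rfl⟩
    exact P.getVert_mem_support n
  · intro i j hij
    rcases lt_or_gt_of_ne hij with h | h
    exacts [hlt _ _ h, (hlt _ _ h).symm]
  · exact fun i => ⟨_, (hσI i).2, σ i, hσN i, rfl⟩
  · intro i j hij
    have hlt : σ i < σ j := σ.strictMono (Fin.lt_def.2 (by omega))
    obtain ⟨n, hn⟩ : ∃ n, σ j = n + 1 := ⟨σ j - 1, by omega⟩
    have hl := (hσI j).1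
    refine ⟨P.getVert n, ⟨n, ⟨by omega, by omega, fun l hl => ?_⟩, rfl⟩, P.getVert (σ j),
      ⟨σ j, hσN j, rfl⟩, ?_⟩
    · have : σ j ≤ σ l := σ.monotone (Fin.le_def.2 (by rw [Fin.lt_def] at hl; omega))
      omega
    · rw [hn]
      exact P.adj_getVert_succ (by omega)

/-- Few vertices have neighbors on `t` members of a family of disjoint paths. -/
lemma card_lt_of_disjoint_paths {t m k : ℕ} (hm : 1 ≤ m)
    (hK : ¬ IsMinorOf (completeBipartiteGraph (Fin t) (Fin m)) G)
    (hI : ¬ IsMinorOf (IplusP (t - 1) m) G) {Z : Finset V} (hZ : Z.card ≤ k) (e : V → V)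
    (P : ∀ z, G.Walk z (e z)) (hP : ∀ z ∈ Z, (P z).IsPath)
    (hdisj : ∀ z ∈ Z, ∀ z' ∈ Z, z ≠ z' → ∀ y ∈ (P z).support, y ∉ (P z').support)
    {A : Finset V}
    (hA : ∀ v ∈ A, ∃ T ⊆ Z, T.card = t ∧ ∀ z ∈ T, ∃ y ∈ (P z).support, G.Adj v y) :
    A.card < 2 ^ k * (k + 1) * m := by
  by_contra! hcard
  choose! T hTZ hTt hTadj using hA
  let loc : V → Option V := fun v =>
    if h : ∃ z ∈ Z, v ∈ (P z).support then some h.choose else none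
  have hloc_mem : ∀ v z, loc v = some z → z ∈ Z ∧ v ∈ (P z).support := by
    intro v z h
    simp only [loc] at h
    split_ifs at h with h'
    cases h
    exact h'.choose_spec
  have hloc_ne : ∀ v, ∀ z ∈ Z, loc v ≠ some z → v ∉ (P z).support := by
    intro v z hz h hv
    have h' : ∃ z ∈ Z, v ∈ (P z).support := ⟨z, hz, hv⟩
    have h1 : loc v = some h'.choose := dif_pos h'
    have h2 : h'.choose ≠ z := fun h3 => h (h3 ▸ h1)
    exact hdisj _ h'.choose_spec.1 z hz h2 v h'.choose_spec.2 hv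
  have hmaps : ∀ v ∈ A, (T v, loc v) ∈ Z.powerset ×ˢ Finset.insertNone Z := by
    intro v hv
    refine Finset.mem_product.2 ⟨Finset.mem_powerset.2 (hTZ v hv), ?_⟩
    exact Finset.mem_insertNone.2 fun z hz => (hloc_mem v z hz).1
  obtain ⟨⟨T₀, l⟩, -, hfib⟩ := Finset.exists_le_card_fiber_of_mul_le_card_of_maps_to (n := m) hmaps
    ⟨(∅, none), by simp⟩ (by
      rw [Finset.card_product, Finset.card_powerset, Finset.card_insertNone]
      refine le_trans ?_ hcard
      gcongr
      exact one_le_two)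
  set M := A.filter fun v => (T v, loc v) = (T₀, l) with hMdef
  have hM : ∀ v ∈ M, v ∈ A ∧ T v = T₀ ∧ loc v = l := by simp [hMdef]
  obtain ⟨v₀, hv₀⟩ : M.Nonempty := Finset.card_pos.1 (hm.trans hfib)
  have hT₀Z : T₀ ⊆ Z := (hM v₀ hv₀).2.1 ▸ hTZ v₀ (hM v₀ hv₀).1
  have hT₀t : T₀.card = t := (hM v₀ hv₀).2.1 ▸ hTt v₀ (hM v₀ hv₀).1
  have hadj : ∀ v ∈ M, ∀ z ∈ T₀, ∃ y ∈ (P z).support, G.Adj v y := fun v hv z hz =>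
    hTadj v (hM v hv).1 z ((hM v hv).2.1.symm ▸ hz)
  have hdisj' : ∀ z ∈ Z, ∀ z' ∈ Z, z ≠ z' →
      Disjoint {x | x ∈ (P z).support} {x | x ∈ (P z').support} := fun z hz z' hz' h =>
    Set.disjoint_left.2 (hdisj z hz z' hz' h)
  by_cases hl : ∃ z ∈ T₀, l = some z
  · obtain ⟨z, hz, rfl⟩ := hl
    obtain ⟨K, hKc, hKs, hKd, hKM, hKK⟩ := exists_path_segments (hP z (hT₀Z hz)) hfib
      fun v hv => (hloc_mem v z (hM v hv).2.2).2
    refine hI (IplusP_isMinorOf (T := T₀.erase z) (by rw [Finset.card_erase_of_mem hz, hT₀t])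
      (fun z => {x | x ∈ (P z).support}) K (fun z _ => (P z).connected_induce_support) hKc
      (fun a ha b hb => hdisj' a (hT₀Z (Finset.mem_of_mem_erase ha)) b
        (hT₀Z (Finset.mem_of_mem_erase hb))) hKd ?_ ?_ hKK)
    · intro a ha i
      exact (hdisj' a (hT₀Z (Finset.mem_of_mem_erase ha)) z (hT₀Z hz)
        (Finset.ne_of_mem_erase ha)).mono_right (hKs i)
    · intro a ha i
      obtain ⟨v, hv, hvK⟩ := hKM i
      obtain ⟨y, hy, hvy⟩ := hadj v hv a (Finset.mem_of_mem_erase ha)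
      exact ⟨y, hy, v, hvK, hvy.symm⟩
  · push Not at hl
    refine hK (completeBipartite_isMinorOf hT₀t hfib (fun z => {x | x ∈ (P z).support})
      (fun v => {v}) (fun z _ => (P z).connected_induce_support)
      (fun v _ => connected_singleton v)
      (fun a ha b hb => hdisj' a (hT₀Z ha) b (hT₀Z hb)) (fun a _ b _ h => by simpa using h)
      ?_ ?_)
    · intro z hz v hv
      rw [Set.disjoint_singleton_right]
      exact hloc_ne v z (hT₀Z hz) ((hM v hv).2.2 ▸ hl z hz)
    · intro z hz v hv
      obtain ⟨y, hy, hvy⟩ := hadj v hv z hz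
      exact ⟨y, hy, v, rfl, hvy.symm⟩

/-- Few disjoint connected sets attach to at least `t` vertices of a small set. -/
lemma card_lt_of_attached [Fintype V] {t m k : ℕ} (hm : 1 ≤ m)
    (hK : ¬ IsMinorOf (completeBipartiteGraph (Fin t) (Fin m)) G) {N : Finset V}
    (hN : N.card ≤ k) {𝒟 : Finset (Finset V)}
    (hconn : ∀ D ∈ 𝒟, (G.induce (D : Set V)).Connected)
    (hdisj : ∀ D ∈ 𝒟, ∀ D' ∈ 𝒟, D ≠ D' → Disjoint D D')
    (hsub : ∀ D ∈ 𝒟, boundary G D ⊆ N) (ht : ∀ D ∈ 𝒟, t ≤ (boundary G D).card) :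
    𝒟.card < 2 ^ k * m := by
  by_contra! hcard
  have : ∀ D ∈ 𝒟, ∃ T ⊆ boundary G D, T.card = t := fun D hD =>
    Finset.exists_subset_card_eq (ht D hD)
  choose! T hT hTt using this
  obtain ⟨T₀, -, hfib⟩ := Finset.exists_le_card_fiber_of_mul_le_card_of_maps_to (n := m)
    (s := 𝒟) (t := N.powerset) (f := T)
    (fun D hD => Finset.mem_powerset.2 ((hT D hD).trans (hsub D hD))) ⟨∅, by simp⟩ (by
      rw [Finset.card_powerset]
      refine le_trans ?_ hcard
      gcongr
      exact one_le_two)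
  set M := 𝒟.filter fun D => T D = T₀ with hMdef
  have hM : ∀ D ∈ M, D ∈ 𝒟 ∧ T D = T₀ := by simp [hMdef]
  obtain ⟨D₀, hD₀⟩ : M.Nonempty := Finset.card_pos.1 (hm.trans hfib)
  have hT₀ : ∀ D ∈ M, ∀ z ∈ T₀, z ∈ boundary G D := fun D hD z hz =>
    hT D (hM D hD).1 ((hM D hD).2.symm ▸ hz)
  refine hK (completeBipartite_isMinorOf ((hM D₀ hD₀).2 ▸ hTt D₀ (hM D₀ hD₀).1) hfib
    (fun z => {z}) (fun D => (D : Set V)) (fun z _ => connected_singleton z)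
    (fun D hD => hconn D (hM D hD).1) (fun a _ b _ h => by simpa using h)
    (fun D hD D' hD' h => Finset.disjoint_coe.2 (hdisj D (hM D hD).1 D' (hM D' hD').1 h)) ?_ ?_)
  · intro z hz D hD
    rw [Set.disjoint_singleton_left]
    exact (mem_boundary.1 (hT₀ D hD z hz)).1
  · intro z hz D hD
    obtain ⟨-, u, hu, huz⟩ := mem_boundary.1 (hT₀ D hD z hz)
    exact ⟨z, rfl, u, hu, huz.symm⟩

end Minors

section Linkage

variable {V : Type*} [Fintype V]

lemma boundary_subset_of_subset {G : SimpleGraph V} {X U : Finset V} (h : X ⊆ U) {y : V}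
    (hy : y ∈ boundary G X) : y ∈ U ∨ y ∈ boundary G U := by
  obtain ⟨-, u, hu, huy⟩ := mem_boundary.1 hy
  by_cases hyU : y ∈ U
  exacts [.inl hyU, .inr (mem_boundary_of_adj (h hu) huy hyU)]

/-- Disjoint walks, one from each boundary vertex of `U₀`, ending on the boundary of `U₁` and
staying between the two boundaries. -/
def IsLinkage (G : SimpleGraph V) (U₀ U₁ : Finset V) (P : ∀ z, Σ y, G.Walk z y) : Prop :=
  (∀ z ∈ boundary G U₀, (P z).1 ∈ boundary G U₁ ∧
    ∀ y ∈ (P z).2.support, y ∉ U₁ ∧ (y ∈ U₀ ∨ y ∈ boundary G U₀)) ∧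
  ∀ z ∈ boundary G U₀, ∀ z' ∈ boundary G U₀, z ≠ z' →
    ∀ y ∈ (P z).2.support, y ∉ (P z').2.support

lemma IsLinkage.append {G : SimpleGraph V} {U₀ X U₁ : Finset V} {P Q : ∀ z, Σ y, G.Walk z y}
    (hP : IsLinkage G U₀ X P) (hQ : IsLinkage G X U₁ Q) (h₁ : U₁ ⊆ X) (h₀ : X ⊆ U₀)
    (hcard : (boundary G X).card ≤ (boundary G U₀).card) :
    IsLinkage G U₀ U₁ fun z => ⟨(Q (P z).1).1, (P z).2.append (Q (P z).1).2⟩ := by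
  have hinj : ∀ z ∈ boundary G U₀, ∀ z' ∈ boundary G U₀, (P z).1 = (P z').1 → z = z' := by
    intro z hz z' hz' h
    by_contra hne
    exact hP.2 z hz z' hz' hne _ (P z).2.end_mem_support (by rw [h]; exact (P z').2.end_mem_support)
  have hsurj := Finset.surjOn_of_injOn_of_card_le (fun z => (P z).1) (fun z hz => (hP.1 z hz).1)
    (fun z hz z' hz' => hinj z hz z' hz') hcard
  have hcross : ∀ z ∈ boundary G U₀, ∀ z' ∈ boundary G U₀, z ≠ z' →
      ∀ y ∈ (P z).2.support, y ∉ (Q (P z').1).2.support := by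
    intro z hz z' hz' hne y hy hy'
    have hyX : y ∈ boundary G X :=
      ((hQ.1 _ (hP.1 z' hz').1).2 y hy').2.resolve_left ((hP.1 z hz).2 y hy).1
    obtain ⟨z'', hz'', rfl⟩ := hsurj hyX
    obtain rfl : z'' = z := by
      by_contra h
      exact hP.2 z'' hz'' z hz h _ (P z'').2.end_mem_support hy
    exact hQ.2 _ hyX _ (hP.1 z' hz').1 (fun h => hne (hinj _ hz _ hz' h)) _
      (Q _).2.start_mem_support hy'
  refine ⟨fun z hz => ⟨(hQ.1 _ (hP.1 z hz).1).1, fun y hy => ?_⟩, fun z hz z' hz' hne y hy hy' => ?_⟩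
  · rcases (Walk.mem_support_append_iff _ _).1 hy with h | h
    · exact ⟨fun hy => ((hP.1 z hz).2 y h).1 (h₁ hy), ((hP.1 z hz).2 y h).2⟩
    · have := (hQ.1 _ (hP.1 z hz).1).2 y h
      exact ⟨this.1, this.2.elim (fun h => .inl (h₀ h)) (boundary_subset_of_subset h₀)⟩
  · rcases (Walk.mem_support_append_iff _ _).1 hy with h | h <;>
      rcases (Walk.mem_support_append_iff _ _).1 hy' with h' | h'
    · exact hP.2 z hz z' hz' hne y h h'
    · exact hcross z hz z' hz' hne y h h'
    · exact hcross z' hz' z hz hne.symm y h' h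
    · exact hQ.2 _ (hP.1 z hz).1 _ (hP.1 z' hz').1 (fun e => hne (hinj _ hz _ hz' e)) y h h'

lemma boundary_deleteIncidenceSet {G : SimpleGraph V} {X : Finset V} {w : V} (hw : w ∉ X) :
    boundary (G.deleteIncidenceSet w) X = (boundary G X).erase w := by
  ext y
  simp only [mem_boundary, Finset.mem_erase, deleteIncidenceSet_adj]
  constructor
  · rintro ⟨hy, u, hu, h, -, hyw⟩
    exact ⟨hyw, hy, u, hu, h⟩
  · rintro ⟨hyw, hy, u, hu, h⟩
    exact ⟨hy, u, hu, h, fun e => hw (e ▸ hu), hyw⟩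

/-- A form of Menger's theorem. -/
theorem exists_linkage (n : ℕ) : ∀ (G : SimpleGraph V) (U₀ U₁ : Finset V) (p : ℕ),
    (U₀ \ U₁).card ≤ n → U₁ ⊆ U₀ → (boundary G U₀).card = p → (boundary G U₁).card = p →
    (∀ X, U₁ ⊆ X → X ⊆ U₀ → p ≤ (boundary G X).card) → ∃ P, IsLinkage G U₀ U₁ P := by
  induction n using Nat.strong_induction_on with | _ n ih => ?_
  intro G U₀ U₁ p hn hsub hp₀ hp₁ hmin
  by_cases hZ : boundary G U₀ ⊆ boundary G U₁
  · refine ⟨fun z => ⟨z, .nil⟩, fun z hz => ⟨hZ hz, fun y hy => ?_⟩, fun z _ z' _ hne y hy hy' => ?_⟩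
    · obtain rfl : y = z := by simpa using hy
      exact ⟨fun h => (mem_boundary.1 hz).1 (hsub h), .inr hz⟩
    · simp only [Walk.support_nil, List.mem_singleton] at hy hy'
      exact hne (hy.symm.trans hy')
  by_cases hX : ∃ X, U₁ ⊂ X ∧ X ⊂ U₀ ∧ (boundary G X).card = p
  · obtain ⟨X, h₁, h₀, hXp⟩ := hX
    have hc₁ : (X \ U₁).card < n := by
      refine lt_of_lt_of_le (Finset.card_lt_card ?_) hn
      exact ⟨Finset.sdiff_subset_sdiff h₀.1 le_rfl, fun h => h₀.2 fun x hx => by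
        by_cases hx₁ : x ∈ U₁
        · exact h₁.1 hx₁
        · exact (Finset.mem_sdiff.1 (h (Finset.mem_sdiff.2 ⟨hx, hx₁⟩))).1⟩
    have hc₀ : (U₀ \ X).card < n := by
      refine lt_of_lt_of_le (Finset.card_lt_card ?_) hn
      exact ⟨Finset.sdiff_subset_sdiff le_rfl h₁.1, fun h => h₁.2 fun x hx => by
        by_contra hx₁
        exact (Finset.mem_sdiff.1 (h (Finset.mem_sdiff.2 ⟨h₀.1 hx, hx₁⟩))).2 hx⟩
    obtain ⟨P, hP⟩ := ih _ hc₀ G U₀ X p le_rfl h₀.1 hp₀ hXp fun Y hY => hmin Y (h₁.1.trans hY)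
    obtain ⟨Q, hQ⟩ := ih _ hc₁ G X U₁ p le_rfl h₁.1 hXp hp₁ fun Y hY hY' =>
      hmin Y hY (hY'.trans h₀.1)
    exact ⟨_, hP.append hQ h₁.1 h₀.1 (hXp.trans hp₀.symm).le⟩
  push Not at hX
  obtain ⟨w, hw₀, hw₁⟩ := Finset.not_subset.1 hZ
  obtain ⟨hwU, u, hu, huw⟩ := mem_boundary.1 hw₀
  have hu₁ : u ∉ U₁ := fun h => hw₁ (mem_boundary_of_adj h huw fun h' => hwU (hsub h'))
  have hsub' : U₁ ⊆ U₀.erase u := fun x hx => Finset.mem_erase.2 ⟨fun e => hu₁ (e ▸ hx), hsub hx⟩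
  have herase : ∀ {X : Finset V}, X ⊆ U₀ → w ∉ X := fun h h' => hwU (h h')
  have hbd : ∀ X, X ⊆ U₀ → boundary (G.deleteIncidenceSet w) X = (boundary G X).erase w :=
    fun X h => boundary_deleteIncidenceSet (herase h)
  have hbd₁ : boundary (G.deleteIncidenceSet w) U₁ = boundary G U₁ := by
    rw [hbd _ hsub, Finset.erase_eq_of_notMem hw₁]
  have hmin' : ∀ X, U₁ ⊆ X → X ⊆ U₀.erase u →
      p ≤ (boundary (G.deleteIncidenceSet w) X).card := by
    intro X h₁ h₀
    rcases eq_or_ne U₁ X with rfl | hne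
    · rw [hbd₁, hp₁]
    · have h₀' : X ⊂ U₀ := h₀.trans_ssubset (Finset.erase_ssubset hu)
      have h1 := hX X (h₁.ssubset_of_ne hne) h₀'
      have h2 := hmin X h₁ h₀'.1
      rw [hbd X h₀'.1]
      have := Finset.pred_card_le_card_erase (s := boundary G X) (a := w)
      omega
  have huZ : u ∉ (boundary G U₀).erase w := fun h =>
    (mem_boundary.1 (Finset.mem_of_mem_erase h)).1 hu
  have hcardZ : (insert u ((boundary G U₀).erase w)).card = p := by
    rw [Finset.card_insert_of_notMem huZ, Finset.card_erase_add_one hw₀, hp₀]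
  have hZ' : boundary (G.deleteIncidenceSet w) (U₀.erase u) =
      insert u ((boundary G U₀).erase w) := by
    refine Finset.eq_of_subset_of_card_le ?_
      (hcardZ.trans_le (hmin' _ hsub' le_rfl))
    intro y hy
    rw [hbd _ (Finset.erase_subset _ _)] at hy
    obtain ⟨hyw, hy⟩ := Finset.mem_erase.1 hy
    rcases boundary_subset_of_subset (Finset.erase_subset u U₀) hy with h | h
    · have : y = u := by
        by_contra hne
        exact (mem_boundary.1 hy).1 (Finset.mem_erase.2 ⟨hne, h⟩)
      exact this ▸ Finset.mem_insert_self _ _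
    · exact Finset.mem_insert_of_mem (Finset.mem_erase.2 ⟨hyw, h⟩)
  have hc : (U₀.erase u \ U₁).card < n := by
    refine lt_of_lt_of_le (Finset.card_lt_card ?_) hn
    exact ⟨Finset.sdiff_subset_sdiff (Finset.erase_subset _ _) le_rfl, fun h =>
      Finset.notMem_erase u U₀ (Finset.mem_sdiff.1 (h (Finset.mem_sdiff.2 ⟨hu, hu₁⟩))).1⟩
  obtain ⟨P, hP⟩ := ih _ hc (G.deleteIncidenceSet w) (U₀.erase u) U₁ p le_rfl hsub'
    (by rw [hZ', hcardZ]) (by rw [hbd₁, hp₁]) hmin'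
  unfold IsLinkage at hP
  rw [hZ', hbd₁] at hP
  have hle : G.deleteIncidenceSet w ≤ G := deleteIncidenceSet_le G w
  have hne_w : ∀ z ∈ insert u ((boundary G U₀).erase w), w ∉ (P z).2.support := by
    intro z hz hw
    rcases ((hP.1 z hz).2 w hw).2 with h | h
    · exact hwU (Finset.mem_of_mem_erase h)
    · rcases Finset.mem_insert.1 h with h | h
      · exact hwU (h ▸ hu)
      · exact Finset.notMem_erase _ _ h
  have hu_mem : u ∈ insert u ((boundary G U₀).erase w) := Finset.mem_insert_self _ _
  have hz_mem : ∀ z ∈ boundary G U₀, z ≠ w → z ∈ insert u ((boundary G U₀).erase w) :=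
    fun z hz h => Finset.mem_insert_of_mem (Finset.mem_erase.2 ⟨h, hz⟩)
  have hz_ne : ∀ z ∈ boundary G U₀, z ≠ u := fun z hz e => (mem_boundary.1 hz).1 (e ▸ hu)
  have hstay : ∀ z ∈ insert u ((boundary G U₀).erase w), ∀ y ∈ (P z).2.support,
      y ∉ U₁ ∧ (y ∈ U₀ ∨ y ∈ boundary G U₀) := by
    intro z hz y hy
    obtain ⟨h1, h2⟩ := (hP.1 z hz).2 y hy
    refine ⟨h1, h2.elim (fun h => .inl (Finset.mem_of_mem_erase h)) fun h => ?_⟩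
    rcases Finset.mem_insert.1 h with rfl | h
    exacts [.inl hu, .inr (Finset.mem_of_mem_erase h)]
  obtain ⟨R, hRw, hRw', hR, hR'⟩ : ∃ R : ∀ z, Σ y, G.Walk z y, (R w).1 = (P u).1 ∧
      (∀ y, y ∈ (R w).2.support ↔ y = w ∨ y ∈ (P u).2.support) ∧
      (∀ z, z ≠ w → (R z).1 = (P z).1) ∧
      ∀ z, z ≠ w → ∀ y, y ∈ (R z).2.support ↔ y ∈ (P z).2.support := by
    refine ⟨Function.update (fun z => ⟨(P z).1, (P z).2.mapLe hle⟩) w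
      ⟨(P u).1, .cons huw.symm ((P u).2.mapLe hle)⟩, ?_, ?_, ?_, ?_⟩
    · rw [Function.update_self]
    · intro y
      rw [Function.update_self, Walk.support_cons, Walk.support_mapLe_eq_support, List.mem_cons]
    · intro z hz
      rw [Function.update_of_ne hz]
    · intro z hz y
      rw [Function.update_of_ne hz, Walk.support_mapLe_eq_support]
  refine ⟨R, fun z hz => ?_, fun z hz z' hz' hne y hy hy' => ?_⟩
  · by_cases h : z = w
    · subst h
      refine ⟨hRw ▸ (hP.1 u hu_mem).1, fun y hy => ?_⟩
      rcases (hRw' y).1 hy with rfl | hy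
      · exact ⟨fun h => hwU (hsub h), .inr hz⟩
      · exact hstay u hu_mem y hy
    · exact ⟨hR z h ▸ (hP.1 z (hz_mem z hz h)).1,
        fun y hy => hstay z (hz_mem z hz h) y ((hR' z h y).1 hy)⟩
  · by_cases h : z = w <;> by_cases h' : z' = w
    · exact hne (h.trans h'.symm)
    · subst h
      rw [hR' z' h'] at hy'
      rcases (hRw' y).1 hy with rfl | hy
      · exact hne_w z' (hz_mem z' hz' h') hy'
      · exact hP.2 u hu_mem z' (hz_mem z' hz' h') (hz_ne z' hz').symm y hy hy'
    · subst h'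
      rw [hR' z h] at hy
      rcases (hRw' y).1 hy' with rfl | hy'
      · exact hne_w z (hz_mem z hz h) hy
      · exact hP.2 z (hz_mem z hz h) u hu_mem (hz_ne z hz) y hy hy'
    · exact hP.2 z (hz_mem z hz h) z' (hz_mem z' hz' h') hne y ((hR' z h y).1 hy)
        ((hR' z' h' y).1 hy')

lemma IsLinkage.exists_index {G : SimpleGraph V} {U₀ X U₁ : Finset V}
    {P : ∀ z, Σ y, G.Walk z y} (hP : IsLinkage G U₀ U₁ P) (h₁ : U₁ ⊆ X) (h₀ : X ⊆ U₀)
    (hcard : (boundary G X).card ≤ (boundary G U₀).card) :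
    ∃ f : V → V, Set.InjOn f (boundary G X) ∧
      ∀ y ∈ boundary G X, f y ∈ boundary G U₀ ∧ y ∈ (P (f y)).2.support := by
  have hcross : ∀ z ∈ boundary G U₀, ∃ y ∈ boundary G X, y ∈ (P z).2.support := by
    intro z hz
    by_contra! h
    have hend : (P z).1 ∈ X := by
      refine (boundary_subset_of_subset h₁ (hP.1 z hz).1).resolve_right fun h' => ?_
      exact h _ h' (P z).2.end_mem_support
    have := subset_of_connected_of_disjoint_boundary (P z).2.connected_induce_support
      (P z).2.end_mem_support hend (fun x hx hx' => h x hx' hx)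
    exact (mem_boundary.1 hz).1 (h₀ (this (P z).2.start_mem_support))
  choose! g hgX hgP using hcross
  have hinj : Set.InjOn g (boundary G U₀) := by
    intro z hz z' hz' h
    by_contra hne
    exact hP.2 z hz z' hz' hne _ (hgP z hz) (h ▸ hgP z' hz')
  have hsurj := Finset.surjOn_of_injOn_of_card_le g hgX hinj hcard
  have : ∀ y ∈ boundary G X, ∃ z ∈ boundary G U₀, g z = y := fun y hy => hsurj hy
  choose! f hf hgf using this
  refine ⟨f, fun y hy y' hy' h => ?_, fun y hy => ⟨hf y hy, ?_⟩⟩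
  · rw [← hgf y hy, h, hgf y' hy']
  · have := hgP _ (hf y hy)
    rwa [hgf y hy] at this

end Linkage

section Chains

variable {V : Type*} [Fintype V]

lemma IsLinkage.bypass {G : SimpleGraph V} {U₀ U₁ : Finset V} {P : ∀ z, Σ y, G.Walk z y}
    (hP : IsLinkage G U₀ U₁ P) : IsLinkage G U₀ U₁ fun z => ⟨(P z).1, (P z).2.bypass⟩ :=
  ⟨fun z hz => ⟨(hP.1 z hz).1, fun y hy =>
      (hP.1 z hz).2 y ((P z).2.support_bypass_subset_support hy)⟩,
    fun z hz z' hz' hne y hy hy' => hP.2 z hz z' hz' hne y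
      ((P z).2.support_bypass_subset_support hy) ((P z').2.support_bypass_subset_support hy')⟩

/-- A strictly decreasing sequence of `L + 1` vertex sets with boundaries of size at most `p`. -/
def IsNested (G : SimpleGraph V) (p L : ℕ) (c : ℕ → Finset V) : Prop :=
  (∀ i < L, c (i + 1) ⊂ c i) ∧ ∀ i ≤ L, (boundary G (c i)).card ≤ p

variable {G : SimpleGraph V} {p L : ℕ} {c : ℕ → Finset V}

lemma IsNested.card_add_le (hc : IsNested G p L c) {i : ℕ} : ∀ {h : ℕ}, i + h ≤ L →
    c (i + h) ⊆ c i ∧ (c (i + h)).card + h ≤ (c i).card := by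
  intro h
  induction h with
  | zero => intro _; exact ⟨le_rfl, le_rfl⟩
  | succ h ih =>
    intro hL
    obtain ⟨h1, h2⟩ := ih (by omega)
    have h3 := hc.1 (i + h) (by omega)
    have h4 := Finset.card_lt_card h3
    exact ⟨h3.1.trans h1, by change (c (i + h + 1)).card + _ ≤ _; omega⟩

lemma IsNested.subset (hc : IsNested G p L c) {i j : ℕ} (hij : i ≤ j) (hj : j ≤ L) :
    c j ⊆ c i := by
  obtain ⟨h, rfl⟩ := Nat.exists_eq_add_of_le hij
  exact (hc.card_add_le hj).1

lemma IsNested.boundary_inter_subset (hc : IsNested G p L c) {i j l : ℕ} (hij : i ≤ j)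
    (hjl : j ≤ l) (hl : l ≤ L) :
    boundary G (c i) ∩ boundary G (c l) ⊆ boundary G (c j) := by
  intro y hy
  obtain ⟨hi, hl'⟩ := Finset.mem_inter.1 hy
  refine (boundary_subset_of_subset (hc.subset hjl hl) hl').resolve_left fun h => ?_
  exact (mem_boundary.1 hi).1 (hc.subset hij (hjl.trans hl) h)

lemma IsNested.shift (hc : IsNested G p L c) {a l : ℕ} (h : a + l ≤ L) :
    IsNested G p l fun i => c (a + i) :=
  ⟨fun i hi => hc.1 (a + i) (by omega), fun i hi => hc.2 (a + i) (by omega)⟩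

/-- The length of a chain of sets with boundaries of size at most `p` which guarantees a linked
subchain of length `l`. -/
def linkLength (l : ℕ) : ℕ → ℕ
  | 0 => l
  | p + 1 => (l + 1) * (linkLength l p + 1)

lemma exists_linked_chain (l : ℕ) {S : Finset V} (p : ℕ) : ∀ c : ℕ → Finset V,
    IsNested G p (linkLength l p) c → Disjoint (c 0 \ c (linkLength l p)) S →
    ∃ q ≤ p, ∃ c' : ℕ → Finset V, IsNested G q l c' ∧ Disjoint (c' 0 \ c' l) S ∧
      ∀ X, c' l ⊆ X → X ⊆ c' 0 → q ≤ (boundary G X).card := by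
  induction p with
  | zero => exact fun c hc hS => ⟨0, le_rfl, c, hc, hS, fun _ _ _ => Nat.zero_le _⟩
  | succ p ih =>
    intro c hc hS
    have hlen : ∀ i ≤ linkLength l p, (l + 1) * i + l ≤ linkLength l (p + 1) := fun i hi =>
      calc (l + 1) * i + l ≤ (l + 1) * linkLength l p + (l + 1) :=
            add_le_add (Nat.mul_le_mul_left _ hi) (Nat.le_succ l)
        _ = linkLength l (p + 1) := by rw [linkLength]; ring
    by_cases h : ∃ i ≤ linkLength l p, ∀ X, c ((l + 1) * i + l) ⊆ X → X ⊆ c ((l + 1) * i) →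
        p + 1 ≤ (boundary G X).card
    · obtain ⟨i, hi, hX⟩ := h
      exact ⟨p + 1, le_rfl, _, hc.shift (hlen i hi), hS.mono_left (Finset.sdiff_subset_sdiff
        (hc.subset (Nat.zero_le _) ((Nat.le_add_right _ _).trans (hlen i hi)))
        (hc.subset (hlen i hi) le_rfl)), hX⟩
    · push Not at h
      choose! X hX₁ hX₀ hXp using h
      have hX : IsNested G p (linkLength l p) X := by
        refine ⟨fun i hi => ?_, fun i hi => Nat.lt_succ_iff.1 (hXp i hi)⟩
        refine ((hX₀ (i + 1) hi).trans_ssubset ?_).trans_subset (hX₁ i hi.le)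
        have := hlen (i + 1) hi
        exact hc.1 ((l + 1) * i + l) (by rw [mul_add] at this; omega)
      obtain ⟨q, hq, c', hc'⟩ := ih X hX
        (hS.mono_left (Finset.sdiff_subset_sdiff (hX₀ 0 (Nat.zero_le _))
          ((hc.subset (hlen _ le_rfl) le_rfl).trans (hX₁ _ le_rfl))))
      exact ⟨q, hq.trans p.le_succ, c', hc'⟩

lemma exists_quadruple {α : Type*} {z : ℕ → Finset α} {K : ℕ}
    (hz : ∀ i j l, i ≤ j → j ≤ l → l ≤ L → z i ∩ z l ⊆ z j) (hK : ∀ i ≤ L, (z i).card ≤ K)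
    (g r : ℕ) : ∀ a, a + g * 3 ^ (r + 1) ≤ L →
    K ≤ (z a ∩ z (a + g * 3 ^ (r + 1))).card + r →
    ∃ i h, g ≤ h ∧ a ≤ i ∧ i + 3 * h ≤ a + g * 3 ^ (r + 1) ∧
      z i ∩ z (i + h) ⊆ z i ∩ z (i + 3 * h) ∧
      z (i + h) ∩ z (i + 2 * h) ⊆ z i ∩ z (i + 3 * h) ∧
      z (i + 2 * h) ∩ z (i + 3 * h) ⊆ z i ∩ z (i + 3 * h) := by
  induction r with
  | zero =>
    intro a hL hcard
    have key : ∀ i j, a ≤ i → i ≤ j → j ≤ a + g * 3 ^ (0 + 1) →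
        z i ∩ z j ⊆ z a ∩ z (a + g * 3 ^ (0 + 1)) := by
      intro i j hi hij hj
      refine (Finset.eq_of_subset_of_card_le (fun y hy => ?_) ?_).ge
      · exact Finset.mem_inter.2 ⟨hz a i _ hi (hij.trans hj) hL hy,
          hz a j _ (hi.trans hij) hj hL hy⟩
      · exact ((Finset.card_le_card Finset.inter_subset_left).trans
          (hK i (by omega))).trans hcard
    have h3 : g * 3 ^ (0 + 1) = 3 * g := by ring
    rw [h3] at key
    refine ⟨a, g, le_rfl, le_rfl, by omega, key _ _ ?_ ?_ ?_, key _ _ ?_ ?_ ?_, key _ _ ?_ ?_ ?_⟩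
      <;> omega
  | succ r ih =>
    intro a hL hcard
    have h3 : g * 3 ^ (r + 1 + 1) = 3 * (g * 3 ^ (r + 1)) := by ring
    have hg : g ≤ g * 3 ^ (r + 1) := Nat.le_mul_of_pos_right _ (by positivity)
    rw [h3] at hL hcard ⊢
    set h := g * 3 ^ (r + 1) with hh
    by_cases hall : ∀ i, a ≤ i → i + h ≤ a + 3 * h → z i ∩ z (i + h) ⊆ z a ∩ z (a + 3 * h)
    · refine ⟨a, h, hg, le_rfl, le_rfl, hall _ le_rfl (by omega), ?_, ?_⟩
      · have := hall (a + h) (by omega) (by omega)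
        rwa [add_assoc, ← two_mul] at this
      · have := hall (a + 2 * h) (by omega) (by omega)
        rwa [show a + 2 * h + h = a + 3 * h by ring] at this
    · push Not at hall
      obtain ⟨i, hi, hi', hns⟩ := hall
      have hlt : (z a ∩ z (a + 3 * h)).card < (z i ∩ z (i + h)).card := by
        refine Finset.card_lt_card ⟨fun y hy => ?_, hns⟩
        exact Finset.mem_inter.2 ⟨hz a i _ hi (by omega) hL hy, hz a _ _ (by omega) hi' hL hy⟩
      obtain ⟨i', h', h1, h2, h3, h4⟩ := ih i (by omega) (by omega)
      exact ⟨i', h', h1, by omega, by omega, h4⟩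

/-- Every nonempty set avoiding `S` contains a vertex with `t` neighbors outside the set. -/
def NoIsland (G : SimpleGraph V) (t : ℕ) (S : Finset V) : Prop :=
  ∀ X : Finset V, X.Nonempty → Disjoint X S →
    ∃ v ∈ X, ∃ T : Finset V, T.card = t ∧ ∀ y ∈ T, G.Adj v y ∧ y ∉ X

variable {S : Finset V} {t : ℕ}

lemma IsNested.exists_attached (hno : NoIsland G t S) (hc : IsNested G p L c) {a : ℕ}
    (ha : a + (p + 1) * 3 ^ (p + 1) ≤ L) (hS : Disjoint (c a \ c (a + (p + 1) * 3 ^ (p + 1))) S) :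
    ∃ v ∈ c a, v ∉ c (a + (p + 1) * 3 ^ (p + 1)) ∧ ∃ i ≤ L, ∃ T ⊆ boundary G (c i),
      T.card = t ∧ ∀ y ∈ T, G.Adj v y := by
  obtain ⟨i, h, hh, hi, hi', h1, h2, h3⟩ := exists_quadruple (z := fun i => boundary G (c i))
    (fun i j l hij hjl hl => hc.boundary_inter_subset hij hjl hl) hc.2 (p + 1) p a ha (by omega)
  set j := i + 3 * h with hj
  have hjL : j ≤ L := by omega
  have hcard := (hc.card_add_le (i := i) (h := 3 * h) hjL).2
  rw [← hj] at hcard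
  have hne : (c i \ (c j ∪ boundary G (c j))).Nonempty := by
    rw [Finset.sdiff_nonempty]
    intro hsub
    have := (Finset.card_le_card hsub).trans (Finset.card_union_le _ _)
    have := hc.2 j hjL
    omega
  have hsub : c i \ (c j ∪ boundary G (c j)) ⊆ c a \ c (a + (p + 1) * 3 ^ (p + 1)) :=
    Finset.sdiff_subset_sdiff (hc.subset hi (by omega))
      ((hc.subset hi' ha).trans Finset.subset_union_left)
  obtain ⟨v, hv, T, hT, hvT⟩ := hno _ hne (hS.mono_left hsub)
  obtain ⟨hva, hva'⟩ := Finset.mem_sdiff.1 (hsub hv)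
  simp only [Finset.mem_sdiff, Finset.mem_union, not_or] at hv hvT
  obtain ⟨hvi, hvj, hvj'⟩ := hv
  have hout : ∀ y ∈ T, y ∈ boundary G (c i) ∨ y ∈ boundary G (c j) := by
    intro y hy
    by_cases hyi : y ∈ c i
    · right
      by_contra hyj
      refine (hvT y hy).2 ⟨hyi, fun hyj' => ?_, hyj⟩
      exact hvj' (mem_boundary_of_adj hyj' (hvT y hy).1.symm hvj)
    · exact .inl (mem_boundary_of_adj hvi (hvT y hy).1 hyi)
  refine ⟨v, hva, hva', ?_⟩
  by_cases hv1 : v ∈ c (i + h)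
  · refine ⟨j, hjL, T, fun y hy => (hout y hy).elim (fun hyi => ?_) id, hT, fun y hy => (hvT y hy).1⟩
    refine (Finset.mem_inter.1 (h1 (Finset.mem_inter.2 ⟨hyi, ?_⟩))).2
    exact mem_boundary_of_adj hv1 (hvT y hy).1 fun hy' =>
      (mem_boundary.1 hyi).1 (hc.subset (by omega) (by omega) hy')
  · refine ⟨i, by omega, T, fun y hy => (hout y hy).elim id fun hyj => ?_, hT,
      fun y hy => (hvT y hy).1⟩
    have hv2 : v ∉ c (i + 2 * h) := fun hv => hv1 (hc.subset (by omega) (by omega) hv)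
    rcases boundary_subset_of_subset (hc.subset (show i + 2 * h ≤ j by omega) hjL) hyj with hy2 | hy2
    · have hvZ : v ∈ boundary G (c (i + 2 * h)) :=
        mem_boundary_of_adj hy2 (hvT y hy).1.symm hv2
      have hvZ' : v ∈ boundary G (c (i + h)) :=
        mem_boundary_of_adj (hc.subset (by omega) (by omega) hy2) (hvT y hy).1.symm hv1
      exact absurd (Finset.mem_inter.1 (h2 (Finset.mem_inter.2 ⟨hvZ', hvZ⟩))).2 hvj'
    · exact (Finset.mem_inter.1 (h3 (Finset.mem_inter.2 ⟨hy2, hyj⟩))).1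

/-- The length of a chain avoiding `S` that forces an island or a forbidden minor. -/
def chainLength (K m : ℕ) : ℕ :=
  linkLength (2 ^ K * (K + 1) * m * ((K + 1) * 3 ^ (K + 1))) K

theorem not_isNested_of_noIsland {K m : ℕ} (hm : 1 ≤ m)
    (hK : ¬ IsMinorOf (completeBipartiteGraph (Fin t) (Fin m)) G)
    (hI : ¬ IsMinorOf (IplusP (t - 1) m) G) (hno : NoIsland G t S)
    (hc : IsNested G K (chainLength K m) c) : ¬ Disjoint (c 0 \ c (chainLength K m)) S := by
  intro hS
  obtain ⟨q, hq, c, hc, hS, hmin⟩ := exists_linked_chain _ K c hc hS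
  set N := 2 ^ K * (K + 1) * m with hN
  set w := (K + 1) * 3 ^ (K + 1) with hw
  have hcK : IsNested G K (N * w) c := ⟨hc.1, fun i hi => (hc.2 i hi).trans hq⟩
  have hcard : ∀ i ≤ N * w, (boundary G (c i)).card = q := fun i hi => (hc.2 i hi).antisymm
    (hmin _ (hc.subset hi le_rfl) (hc.subset (Nat.zero_le _) hi))
  obtain ⟨P, hP⟩ := exists_linkage _ G (c 0) (c (N * w)) q le_rfl
    (hc.subset (Nat.zero_le _) le_rfl) (hcard _ (Nat.zero_le _)) (hcard _ le_rfl) hmin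
  have hP := hP.bypass
  have hend : ∀ j < N, j * w + w ≤ N * w := fun j hj =>
    (Nat.succ_mul j w).symm.trans_le (Nat.mul_le_mul_right w hj)
  have hv : ∀ j < N, ∃ v ∈ c (j * w), v ∉ c (j * w + w) ∧ ∃ i ≤ N * w,
      ∃ T ⊆ boundary G (c i), T.card = t ∧ ∀ y ∈ T, G.Adj v y := fun j hj =>
    hcK.exists_attached hno (hend j hj) (hS.mono_left (Finset.sdiff_subset_sdiff
      (hc.subset (Nat.zero_le _) ((Nat.le_add_right _ _).trans (hend j hj)))
      (hc.subset (hend j hj) le_rfl)))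
  have : Nonempty V := ⟨(hv 0 (by positivity)).choose⟩
  choose! v hv₀ hv₁ hvT using hv
  have hne : ∀ j < N, ∀ j' < N, j < j' → v j ≠ v j' := by
    intro j hj j' hj' hlt e
    refine hv₁ j hj (hc.subset ?_ ((Nat.le_add_right _ _).trans (hend j' hj')) (e ▸ hv₀ j' hj'))
    exact (Nat.succ_mul j w).symm.trans_le (Nat.mul_le_mul_right w hlt)
  have hlt := card_lt_of_disjoint_paths (k := K) (A := (Finset.range N).image v) hm hK hI
    ((hcard 0 (Nat.zero_le _)).trans_le hq) _ (fun z => (P z).2.bypass)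
    (fun z _ => (P z).2.bypass_isPath) hP.2 ?_
  · rw [Finset.card_image_of_injOn, Finset.card_range] at hlt
    · exact lt_irrefl _ hlt
    · intro j hj j' hj' e
      rcases lt_trichotomy j j' with h | h | h
      · exact absurd e (hne j (by simpa using hj) j' (by simpa using hj') h)
      · exact h
      · exact absurd e.symm (hne j' (by simpa using hj') j (by simpa using hj) h)
  · intro u hu
    obtain ⟨j, hj, rfl⟩ := Finset.mem_image.1 hu
    obtain ⟨i, hi, T, hT, hTt, hadj⟩ := hvT j (Finset.mem_range.1 hj)
    obtain ⟨f, hf, hfP⟩ := hP.exists_index (hc.subset hi le_rfl) (hc.subset (Nat.zero_le _) hi)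
      ((hcard i hi).trans (hcard 0 (Nat.zero_le _)).symm).le
    refine ⟨T.image f, Finset.image_subset_iff.2 fun y hy => (hfP y (hT hy)).1, ?_, ?_⟩
    · rw [Finset.card_image_of_injOn (hf.mono hT), hTt]
    · intro z hz
      obtain ⟨y, hy, rfl⟩ := Finset.mem_image.1 hz
      exact ⟨y, (hfP y (hT hy)).2, hadj y hy⟩

end Chains

section Counting

variable {V : Type*} [Fintype V] {G : SimpleGraph V} {δ : V → ℕ} {S : Finset V} {K m t : ℕ}

/-- The vertex sets of the components of the subgraph induced by `U`. -/
noncomputable def components (G : SimpleGraph V) (U : Finset V) : Finset (Finset V) :=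
  Finset.univ.filter fun D =>
    (G.induce (D : Set V)).Connected ∧ D ⊆ U ∧ Disjoint (boundary G D) U

lemma mem_components {U D : Finset V} : D ∈ components G U ↔
    (G.induce (D : Set V)).Connected ∧ D ⊆ U ∧ Disjoint (boundary G D) U := by
  simp [components]

lemma nonempty_of_connected {α : Type*} {G : SimpleGraph α} {D : Finset α}
    (h : (G.induce (D : Set α)).Connected) :
    D.Nonempty := by
  obtain ⟨x, hx⟩ := h.nonempty
  exact ⟨x, hx⟩

lemma disjoint_of_mem_components {U D D' : Finset V} (hD : D ∈ components G U)
    (hD' : D' ∈ components G U) (hne : D ≠ D') : Disjoint D D' := by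
  have key : ∀ {D D' : Finset V}, D ∈ components G U → D' ∈ components G U → ∀ x ∈ D, x ∈ D' →
      D ⊆ D' := by
    intro D D' hD hD' x hx hx'
    rw [mem_components] at hD hD'
    exact_mod_cast subset_of_connected_of_disjoint_boundary hD.1 (Finset.mem_coe.2 hx) hx'
      fun y hy hy' => Finset.disjoint_left.1 hD'.2.2 hy' (hD.2.1 hy)
  by_contra h
  obtain ⟨x, hx, hx'⟩ := Finset.not_disjoint_iff.1 h
  exact hne ((key hD hD' x hx hx').antisymm (key hD' hD x hx' hx))

lemma exists_mem_components {U : Finset V} {x : V} (hx : x ∈ U) :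
    ∃ D ∈ components G U, x ∈ D := by
  obtain ⟨D, hD, hmax⟩ := Finset.exists_max_image
    (Finset.univ.filter fun D : Finset V => (G.induce (D : Set V)).Connected ∧ D ⊆ U ∧ x ∈ D)
    Finset.card ⟨{x}, Finset.mem_filter.2 ⟨Finset.mem_univ _,
      by rw [Finset.coe_singleton]; exact connected_singleton x, by simpa using hx, by simp⟩⟩
  simp only [Finset.mem_filter, Finset.mem_univ, true_and] at hD hmax
  refine ⟨D, mem_components.2 ⟨hD.1, hD.2.1, Finset.disjoint_left.2 fun y hy hyU => ?_⟩, hD.2.2⟩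
  obtain ⟨hyD, u, hu, huy⟩ := mem_boundary.1 hy
  have hconn : (G.induce ((insert y D : Finset V) : Set V)).Connected := by
    refine connected_of_closed (a := x) (by simp [hD.2.2]) fun B hxB hB => ?_
    have hDB : (D : Set V) ⊆ B := subset_of_connected hD.1 (Finset.mem_coe.2 hD.2.2) hxB
      fun a ha haD b hb hab => hB a ha (by simp [Finset.mem_coe.1 haD]) b
        (by simp [Finset.mem_coe.1 hb]) hab
    have hyB : y ∈ B := hB u (hDB hu) (by simp [hu]) y (by simp) huy
    intro z hz
    rcases Finset.mem_insert.1 (Finset.mem_coe.1 hz) with rfl | hz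
    exacts [hyB, hDB hz]
  have := hmax (insert y D) ⟨hconn, Finset.insert_subset hyU hD.2.1, Finset.mem_insert_of_mem hD.2.2⟩
  rw [Finset.card_insert_of_notMem hyD] at this
  omega

lemma card_eq_sum_components (U : Finset V) : U.card = ∑ D ∈ components G U, D.card := by
  rw [← Finset.card_biUnion (t := fun D => D)
    fun D hD D' hD' hne => disjoint_of_mem_components hD hD' hne]
  congr 1
  ext x
  rw [Finset.mem_biUnion]
  exact ⟨exists_mem_components, fun ⟨D, hD, hx⟩ => (mem_components.1 hD).2.1 hx⟩

lemma sum_card_inter_le (U : Finset V) {𝒟 : Finset (Finset V)} (h : 𝒟 ⊆ components G U) :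
    ∑ D ∈ 𝒟, (D ∩ S).card ≤ (U ∩ S).card := by
  rw [← Finset.card_biUnion (t := fun D => D ∩ S) fun D hD D' hD' hne =>
    (disjoint_of_mem_components (h hD) (h hD') hne).mono
      Finset.inter_subset_left Finset.inter_subset_left]
  refine Finset.card_le_card (Finset.biUnion_subset.2 fun D hD => ?_)
  exact Finset.inter_subset_inter_right (mem_components.1 (h hD)).2.1

/-- A connected set whose boundary lies no deeper than the set, with respect to the depth
function `δ`. -/
def IsFam (G : SimpleGraph V) (δ : V → ℕ) (U : Finset V) : Prop :=
  (G.induce (U : Set V)).Connected ∧ ∀ w ∈ boundary G U, ∀ u ∈ U, δ w ≤ δ u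

/-- There is a chain of `r` proper inclusions below `U` which only removes vertices outside `S`. -/
def HasFreeChain (G : SimpleGraph V) (δ : V → ℕ) (S : Finset V) : ℕ → Finset V → Prop
  | 0, _ => True
  | r + 1, U => ∃ D, IsFam G δ D ∧ D ⊂ U ∧ Disjoint (U \ D) S ∧ HasFreeChain G δ S r D

lemma HasFreeChain.exists_isNested (hδ : ∀ U, IsFam G δ U → (boundary G U).card ≤ K) (r : ℕ) :
    ∀ U, IsFam G δ U → HasFreeChain G δ S r U →
      ∃ c, c 0 = U ∧ IsNested G K r c ∧ Disjoint (c 0 \ c r) S := by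
  induction r with
  | zero =>
    exact fun U hU _ => ⟨fun _ => U, rfl, ⟨fun _ h => absurd h (Nat.not_lt_zero _),
      fun _ _ => hδ U hU⟩, by simp⟩
  | succ r ih =>
    rintro U hU ⟨D, hD, hDU, hdis, hfree⟩
    obtain ⟨c, hc₀, hc, hcS⟩ := ih D hD hfree
    refine ⟨fun i => Nat.casesOn i U c, rfl, ⟨fun i hi => ?_, fun i hi => ?_⟩, ?_⟩
    · cases i with
      | zero => exact hc₀.trans_ssubset hDU
      | succ i => exact hc.1 i (Nat.succ_lt_succ_iff.1 hi)
    · cases i with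
      | zero => exact hδ U hU
      | succ i => exact hc.2 i (Nat.succ_le_succ_iff.1 hi)
    · rw [hc₀] at hcS
      refine Finset.disjoint_left.2 fun x hx hxS => ?_
      obtain ⟨hxU, hxc⟩ := Finset.mem_sdiff.1 hx
      by_cases hxD : x ∈ D
      · exact Finset.disjoint_left.1 hcS (Finset.mem_sdiff.2 ⟨hxD, hxc⟩) hxS
      · exact Finset.disjoint_left.1 hdis (Finset.mem_sdiff.2 ⟨hxU, hxD⟩) hxS

lemma NoIsland.le_card_boundary (hno : NoIsland G t S) {D : Finset V} (hD : D.Nonempty)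
    (hS : Disjoint D S) : t ≤ (boundary G D).card := by
  obtain ⟨v, hv, T, rfl, hT⟩ := hno D hD hS
  exact Finset.card_le_card fun y hy => mem_boundary_of_adj hv (hT y hy).1 (hT y hy).2

/-- A set of the family decomposes into a vertex and disjoint smaller members of the family, few
of which avoid `S`. -/
lemma IsFam.exists_children (hδ : ∀ U, IsFam G δ U → (boundary G U).card ≤ K) (hm : 1 ≤ m)
    (hK : ¬ IsMinorOf (completeBipartiteGraph (Fin t) (Fin m)) G) (hno : NoIsland G t S)
    {U : Finset V} (hU : IsFam G δ U) :
    ∃ v ∈ U, (∀ D ∈ components G (U.erase v), IsFam G δ D ∧ D ⊂ U) ∧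
      ((components G (U.erase v)).filter (Disjoint · S)).card ≤ 2 ^ (K + 1) * m := by
  obtain ⟨v, hv, hmin⟩ := U.exists_min_image δ (nonempty_of_connected hU.1)
  have hbd : ∀ D ∈ components G (U.erase v), boundary G D ⊆ insert v (boundary G U) := by
    intro D hD y hy
    obtain ⟨-, hDU, hdis⟩ := mem_components.1 hD
    rcases boundary_subset_of_subset (hDU.trans (Finset.erase_subset _ _)) hy with h | h
    · by_cases hyv : y = v
      · exact hyv ▸ Finset.mem_insert_self _ _
      · exact absurd (Finset.mem_erase.2 ⟨hyv, h⟩) (Finset.disjoint_left.1 hdis hy)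
    · exact Finset.mem_insert_of_mem h
  refine ⟨v, hv, fun D hD => ⟨⟨(mem_components.1 hD).1, fun w hw u hu => ?_⟩, ?_⟩, ?_⟩
  · have huU := Finset.mem_of_mem_erase ((mem_components.1 hD).2.1 hu)
    rcases Finset.mem_insert.1 (hbd D hD hw) with rfl | h
    exacts [hmin u huU, hU.2 w h u huU]
  · exact (mem_components.1 hD).2.1.trans_ssubset (Finset.erase_ssubset hv)
  · refine (card_lt_of_attached (N := insert v (boundary G U)) hm hK ?_ (fun D hD => ?_)
      (fun D hD D' hD' hne => ?_) (fun D hD => ?_) fun D hD => ?_).le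
    · exact (Finset.card_insert_le _ _).trans (Nat.succ_le_succ (hδ U hU))
    · exact (mem_components.1 (Finset.mem_filter.1 hD).1).1
    · exact disjoint_of_mem_components (Finset.mem_filter.1 hD).1 (Finset.mem_filter.1 hD').1 hne
    · exact hbd D (Finset.mem_filter.1 hD).1
    · exact hno.le_card_boundary
        (nonempty_of_connected (mem_components.1 (Finset.mem_filter.1 hD).1).1)
        (Finset.mem_filter.1 hD).2

/-- A bound for the size of a set avoiding `S` without a chain of `r` proper inclusions. -/
def freeBound (d : ℕ) : ℕ → ℕ
  | 0 => 0
  | r + 1 => 1 + d * freeBound d r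

lemma card_le_freeBound (hδ : ∀ U, IsFam G δ U → (boundary G U).card ≤ K) (hm : 1 ≤ m)
    (hK : ¬ IsMinorOf (completeBipartiteGraph (Fin t) (Fin m)) G) (hno : NoIsland G t S) (r : ℕ) :
    ∀ U, IsFam G δ U → Disjoint U S → ¬ HasFreeChain G δ S r U →
      U.card ≤ freeBound (2 ^ (K + 1) * m) r := by
  induction r with
  | zero => exact fun U _ _ h => absurd trivial h
  | succ r ih =>
    intro U hU hS hfree
    obtain ⟨v, hv, hch, hcard⟩ := hU.exists_children hδ hm hK hno
    have hSD : ∀ D ∈ components G (U.erase v), Disjoint D S := fun D hD =>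
      hS.mono_left (hch D hD).2.1
    rw [Finset.filter_true_of_mem hSD] at hcard
    rw [← Finset.card_erase_add_one hv, card_eq_sum_components (G := G), add_comm, freeBound]
    refine Nat.add_le_add_left ((Finset.sum_le_card_nsmul _ _ _ fun D hD => ?_).trans
      (Nat.mul_le_mul_right (freeBound (2 ^ (K + 1) * m) r) hcard)) 1
    exact ih D (hch D hD).1 (hSD D hD) fun h => hfree
      ⟨D, (hch D hD).1, (hch D hD).2, hS.mono_left Finset.sdiff_subset, h⟩

lemma card_le_of_not_hasFreeChain (hδ : ∀ U, IsFam G δ U → (boundary G U).card ≤ K) (hm : 1 ≤ m)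
    (hK : ¬ IsMinorOf (completeBipartiteGraph (Fin t) (Fin m)) G) (hno : NoIsland G t S)
    {L M A : ℕ} (hL : ∀ U, IsFam G δ U → ¬ HasFreeChain G δ S L U)
    (hM : M = 1 + 2 ^ (K + 1) * m * freeBound (2 ^ (K + 1) * m) L) (hA : A = 2 * M * (L + 1))
    (n : ℕ) : ∀ U r, U.card ≤ n → IsFam G δ U → ¬ Disjoint U S → ¬ HasFreeChain G δ S r U → r ≤ L →
      (U.card : ℤ) ≤ A * (2 * (U ∩ S).card - 1) + M * r := by
  induction n using Nat.strong_induction_on with | _ n ih => ?_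
  intro U r hn hU hS hfree hr
  obtain ⟨v, hv, hch, hcard⟩ := hU.exists_children hδ hm hK hno
  set 𝒟 := components G (U.erase v) with h𝒟
  set ℬ := 𝒟.filter (¬ Disjoint · S) with hℬ
  have hsum : U.card ≤ M + ∑ D ∈ ℬ, D.card := by
    rw [← Finset.card_erase_add_one hv, card_eq_sum_components (G := G), ← h𝒟, hM]
    have hsplit : ∑ D ∈ 𝒟.filter (Disjoint · S), D.card + ∑ D ∈ ℬ, D.card = ∑ D ∈ 𝒟, D.card := by
      rw [← Finset.sum_filter_add_sum_filter_not 𝒟 (Disjoint · S)]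
    have : ∑ D ∈ 𝒟.filter (Disjoint · S), D.card ≤
        2 ^ (K + 1) * m * freeBound (2 ^ (K + 1) * m) L := by
      refine (Finset.sum_le_card_nsmul _ _ _ fun D hD => ?_).trans
        (Nat.mul_le_mul_right (freeBound (2 ^ (K + 1) * m) L) hcard)
      obtain ⟨hD, hDS⟩ := Finset.mem_filter.1 hD
      exact card_le_freeBound hδ hm hK hno L D (hch D hD).1 hDS (hL D (hch D hD).1)
    omega
  have hlt : ∀ D ∈ 𝒟, D.card < n := fun D hD =>
    (Finset.card_lt_card (hch D hD).2).trans_le hn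
  have hmem : ∀ D ∈ ℬ, D ∈ 𝒟 ∧ ¬ Disjoint D S := fun D hD => Finset.mem_filter.1 hD
  have hbad : (∑ D ∈ ℬ, D.card : ℤ) ≤ 2 * A * ∑ D ∈ ℬ, ((D ∩ S).card : ℤ) - ℬ.card * (A - M * L) := by
    rw [Finset.mul_sum, ← nsmul_eq_mul, ← Finset.sum_const, ← Finset.sum_sub_distrib]
    refine Finset.sum_le_sum fun D hD => ?_
    obtain ⟨hD, hDS⟩ := hmem D hD
    have := ih _ (hlt D hD) D L le_rfl (hch D hD).1 hDS (hL D (hch D hD).1) le_rfl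
    linarith
  have hinter : ∑ D ∈ ℬ, (D ∩ S).card ≤ (U.erase v ∩ S).card :=
    sum_card_inter_le _ (Finset.filter_subset _ _)
  have hsum' : (U.card : ℤ) ≤ M + ∑ D ∈ ℬ, (D.card : ℤ) := by exact_mod_cast hsum
  have hinter' : (∑ D ∈ ℬ, ((D ∩ S).card : ℤ)) ≤ (U.erase v ∩ S).card := by
    exact_mod_cast hinter
  have hA' : (A : ℤ) = 2 * M * L + 2 * M := by rw [hA]; push_cast; ring
  have hML : (0 : ℤ) ≤ M * L := by positivity
  have hMr : (0 : ℤ) ≤ M * r := by positivity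
  have hM0 : (0 : ℤ) ≤ M := by positivity
  have hA0 : (0 : ℤ) ≤ A := by positivity
  have hmul := mul_le_mul_of_nonneg_left hinter' (by positivity : (0 : ℤ) ≤ 2 * A)
  by_cases hvS : v ∈ S
  · have herase : (U.erase v ∩ S).card + 1 = (U ∩ S).card := by
      rw [Finset.erase_inter, Finset.card_erase_add_one (Finset.mem_inter.2 ⟨hv, hvS⟩)]
    rw [← herase]
    push_cast
    have : (0 : ℤ) ≤ ℬ.card * (A - M * L) := mul_nonneg (by positivity) (by nlinarith)
    linarith
  have herase : U.erase v ∩ S = U ∩ S := by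
    rw [Finset.erase_inter, Finset.erase_eq_of_notMem fun h => hvS (Finset.mem_inter.1 h).2]
  rw [herase] at hmul
  have hcover : ∀ x ∈ U, x ∈ S → ∃ D ∈ ℬ, x ∈ D := by
    intro x hx hxS
    obtain ⟨D, hD, hxD⟩ := exists_mem_components (G := G)
      (Finset.mem_erase.2 ⟨fun e : x = v => hvS (e ▸ hxS), hx⟩)
    exact ⟨D, Finset.mem_filter.2 ⟨hD, Finset.not_disjoint_iff.2 ⟨x, hxD, hxS⟩⟩, hxD⟩
  obtain ⟨x, hx, hxS⟩ := Finset.not_disjoint_iff.1 hS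
  obtain ⟨D, hD, -⟩ := hcover x hx hxS
  rcases (Nat.succ_le_iff.2 (Finset.card_pos.2 ⟨D, hD⟩)).eq_or_lt with h1 | h2
  · obtain ⟨D', hD'⟩ := Finset.card_eq_one.1 h1.symm
    rw [hD', Finset.sum_singleton] at hsum'
    rw [hD'] at hcover hmem
    obtain ⟨hD, hDS⟩ := hmem D' (Finset.mem_singleton_self _)
    cases r with
    | zero => exact absurd trivial hfree
    | succ r =>
      have hfree' : ¬ HasFreeChain G δ S r D' := fun h => by
        refine hfree ⟨D', (hch D' hD).1, (hch D' hD).2, Finset.disjoint_left.2 fun y hy hyS => ?_, h⟩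
        obtain ⟨hyU, hyD⟩ := Finset.mem_sdiff.1 hy
        obtain ⟨D'', hD'', hyD''⟩ := hcover y hyU hyS
        exact hyD (Finset.mem_singleton.1 hD'' ▸ hyD'')
      have hDU := ih _ (hlt D' hD) D' r le_rfl (hch D' hD).1 hDS hfree' (by omega)
      have : ((D' ∩ S).card : ℤ) ≤ (U ∩ S).card := by
        exact_mod_cast Finset.card_le_card (Finset.inter_subset_inter_right (hch D' hD).2.1)
      have := mul_le_mul_of_nonneg_left this hA0
      push_cast
      linarith
  · have : (2 : ℤ) * (A - M * L) ≤ ℬ.card * (A - M * L) :=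
      mul_le_mul_of_nonneg_right (by exact_mod_cast h2) (by linarith)
    linarith

/-- The factor by which a set meeting every island may be smaller than the vertex set. -/
def islandFactor (K m : ℕ) : ℕ :=
  4 * (1 + 2 ^ (K + 1) * m * freeBound (2 ^ (K + 1) * m) (chainLength K m)) *
    (chainLength K m + 1)

theorem card_le_of_noIsland (hδ : ∀ U, IsFam G δ U → (boundary G U).card ≤ K) (hm : 1 ≤ m)
    (ht : 1 ≤ t) (hK : ¬ IsMinorOf (completeBipartiteGraph (Fin t) (Fin m)) G)
    (hI : ¬ IsMinorOf (IplusP (t - 1) m) G) (hno : NoIsland G t S) :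
    Fintype.card V ≤ islandFactor K m * S.card := by
  have hL : ∀ U, IsFam G δ U → ¬ HasFreeChain G δ S (chainLength K m) U := by
    intro U hU hfree
    obtain ⟨c, -, hc, hcS⟩ := hfree.exists_isNested hδ _ U hU
    exact not_isNested_of_noIsland hm hK hI hno hc hcS
  have hbd : ∀ D ∈ components G Finset.univ, boundary G D = ∅ := fun D hD =>
    Finset.eq_empty_of_forall_notMem fun x hx =>
      Finset.disjoint_left.1 (mem_components.1 hD).2.2 hx (Finset.mem_univ x)
  have hD : ∀ D ∈ components G Finset.univ, D.card ≤ islandFactor K m * (D ∩ S).card := by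
    intro D hD
    have hconn := (mem_components.1 hD).1
    have hDS : ¬ Disjoint D S := fun h => by
      have := hno.le_card_boundary (nonempty_of_connected hconn) h
      rw [hbd D hD, Finset.card_empty] at this
      omega
    have hfam : IsFam G δ D := ⟨hconn, by simp [hbd D hD]⟩
    have := card_le_of_not_hasFreeChain hδ hm hK hno hL rfl rfl _ D _ le_rfl hfam hDS
      (hL D hfam) le_rfl
    have h2 : (D.card : ℤ) ≤ islandFactor K m * (D ∩ S).card := by
      refine this.trans ?_
      rw [islandFactor]
      generalize 1 + 2 ^ (K + 1) * m * freeBound (2 ^ (K + 1) * m) (chainLength K m) = M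
      have : (0 : ℤ) ≤ M * chainLength K m := by positivity
      have : (0 : ℤ) ≤ M := by positivity
      push_cast
      linarith
    exact_mod_cast h2
  calc Fintype.card V = ∑ D ∈ components G Finset.univ, D.card := by
        rw [← card_eq_sum_components, Finset.card_univ]
    _ ≤ ∑ D ∈ components G Finset.univ, islandFactor K m * (D ∩ S).card := Finset.sum_le_sum hD
    _ ≤ islandFactor K m * S.card := by
        rw [← Finset.mul_sum]
        refine Nat.mul_le_mul_left _ ((sum_card_inter_le Finset.univ subset_rfl).trans ?_)
        rw [Finset.univ_inter]

end Counting

end Islands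

/-- for all `k ≥ 0` and `m, t ≥ 1` there are `ε, C > 0` such that every
graph `G` on at least `C` vertices of treewidth at most `k` with no `K_{t,m}` or
`I_{t-1}+P_m` minor contains, for every set `S` with `|S| ≤ ε|V(G)| + 2k + 3`, a
`t`-island disjoint from `S`. -/
theorem stmt19 (k m t : ℕ) (hm : 1 ≤ m) (ht : 1 ≤ t) :
    ∃ ε C : ℝ, 0 < ε ∧ 0 < C ∧
      ∀ (n : ℕ) (G : SimpleGraph (Fin n)), C ≤ (n : ℝ) → HasTreewidthAtMost G k →
        ¬ IsMinorOf (completeBipartiteGraph (Fin t) (Fin m)) G →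
        ¬ IsMinorOf (IplusP (t-1) m) G →
        ∀ S : Set (Fin n), (S.ncard : ℝ) ≤ ε * n + 2 * k + 3 →
          ∃ I : Set (Fin n), IsIsland G t I ∧ Disjoint I S := by
  classical
  have hpos : (0 : ℝ) < Islands.islandFactor (k + 1) m :=
    Nat.cast_pos.2 (by rw [Islands.islandFactor]; positivity)
  set A : ℝ := (Islands.islandFactor (k + 1) m : ℝ) with hA
  refine ⟨1 / (2 * A), 2 * A * (2 * k + 3) + 1, by positivity, by positivity, ?_⟩
  intro n G hn htw hK hI S hS
  by_contra! hno
  have hno' : Islands.NoIsland G t S.toFinset := by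
    intro X hX hXS
    have hX' : ¬ IsIsland G t (X : Set (Fin n)) := fun h => hno X h
      (Set.disjoint_left.2 fun x hx hxS => Finset.disjoint_left.1 hXS hx (Set.mem_toFinset.2 hxS))
    simp only [IsIsland, Finset.coe_nonempty, hX, true_and, not_forall, not_lt] at hX'
    obtain ⟨v, hv, hvt⟩ := hX'
    rw [Set.ncard_eq_toFinset_card'] at hvt
    obtain ⟨T, hT, hTt⟩ := Finset.exists_subset_card_eq hvt
    exact ⟨v, hv, T, hTt, fun y hy => by simpa using hT hy⟩
  obtain ⟨δ, hδ⟩ := Islands.exists_depth htw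
  have hcard := Islands.card_le_of_noIsland (δ := δ) (fun U hU => hδ U hU.1 hU.2) hm ht hK hI hno'
  rw [Fintype.card_fin, ← Set.ncard_eq_toFinset_card'] at hcard
  have hcard' : (n : ℝ) ≤ A * S.ncard := by rw [hA]; exact_mod_cast hcard
  have h1 := mul_le_mul_of_nonneg_left hS hpos.le
  have h2 : A * (1 / (2 * A) * n + 2 * k + 3) = n / 2 + A * (2 * k + 3) := by
    field_simp
    ring
  linarith
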